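/- Let u, v, w, z be orthonormal vectors in ℝ⁸ spanning an L-plane E (Ψ|_E = 0). Then the vectors R_{uvw} = u×v×w, R_{uvz} = u×v×z, R_{uwz} = u×w×z, R_{vwz} = v×w×z are pairwise orthogonal unit vectors, so that {u, v, w, z, R_{uvw}, R_{uvz}, R_{uwz}, R_{vwz}} is an orthonormal basis of ℝ⁸. -/

import Mathlib

noncomputable section

/-- The octonions `𝕆 ≅ ℝ⁸`, realized as pairs of quaternions via Cayley–Dickson. -/
abbrev Octonion : Type := Quaternion ℝ × Quaternion ℝ

/-- Octonion multiplication (Cayley–Dickson doubling of the quaternions). -/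
def omul (p q : Octonion) : Octonion :=
  (p.1 * q.1 - star q.2 * p.2, q.2 * p.1 + p.2 * star q.1)

/-- Octonion conjugation. -/
def oconj (p : Octonion) : Octonion := (star p.1, -p.2)

/-- The standard inner product on the octonions `≅ ℝ⁸`. -/
def oinner (p q : Octonion) : ℝ := (p.1 * star q.1).re + (p.2 * star q.2).re

/-- The triple cross product `u×v×w = ½(u(v̄w) − w(v̄u))`. -/
def tcross (u v w : Octonion) : Octonion :=
  (2 : ℝ)⁻¹ • (omul u (omul (oconj v) w) - omul w (omul (oconj v) u))

/-- The Cayley 4-form `Ψ(u,v,w,z) = ⟨u×v×w, z⟩`. -/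
def cayleyΨ (u v w z : Octonion) : ℝ := oinner (tcross u v w) z

/-- The inner product on the octonions as a bilinear form. -/
def oinnerForm : LinearMap.BilinForm ℝ Octonion :=
  LinearMap.mk₂ ℝ oinner
    (fun p q r => by simp [oinner, add_mul]; ring)
    (fun c p q => by simp [oinner]; ring)
    (fun p q r => by simp [oinner]; ring)
    (fun c p q => by simp [oinner]; ring)

theorem oinnerForm_apply (p q : Octonion) : oinnerForm p q = oinner p q := rfl

theorem oinner_comm (p q : Octonion) : oinner p q = oinner q p := by
  simp [oinner]; ring

theorem oinner_neg_left (p q : Octonion) : oinner (-p) q = -oinner p q := by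
  simp only [← oinnerForm_apply, map_neg, LinearMap.neg_apply]

theorem oinner_neg_right (p q : Octonion) : oinner p (-q) = -oinner p q := by
  simp only [← oinnerForm_apply, map_neg]

theorem oinner_omul_left (a b c : Octonion) :
    oinner (omul a b) (omul a c) = oinner a a * oinner b c := by
  simp [oinner, omul]; ring

theorem oinner_oconj (p q : Octonion) : oinner (oconj p) (oconj q) = oinner p q := by
  simp [oinner, oconj]

set_option maxHeartbeats 2000000 in
theorem omul_oconj_add (u w x : Octonion) :
    omul u (omul (oconj w) x) + omul w (omul (oconj u) x) = (2 * oinner u w) • x := by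
  ext <;> simp [oinner, omul, oconj] <;> ring

theorem omul_neg_right (p q : Octonion) : omul p (-q) = -omul p q := by
  ext <;> simp [omul] <;> ring

theorem oconj_omul_add (v w : Octonion) :
    omul (oconj v) w + omul (oconj w) v = (((2 * oinner v w : ℝ) : Quaternion ℝ), (0 : Quaternion ℝ)) := by
  ext <;> simp [oinner, omul, oconj] <;> ring

theorem oconj_omul_of_orthogonal {v w : Octonion} (h : oinner v w = 0) :
    omul (oconj v) w = -omul (oconj w) v := by
  have := oconj_omul_add v w
  rw [h, mul_zero, Quaternion.coe_zero] at this
  exact eq_neg_of_add_eq_zero_left this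

theorem omul_oconj_of_orthogonal {u w : Octonion} (h : oinner u w = 0) (x : Octonion) :
    omul u (omul (oconj w) x) = -omul w (omul (oconj u) x) := by
  have := omul_oconj_add u w x
  rw [h, mul_zero, zero_smul] at this
  exact eq_neg_of_add_eq_zero_left this

/-- On mutually orthogonal vectors the triple cross product is `u(v̄w)`. -/
theorem tcross_of_orthogonal {u v w : Octonion} (huv : oinner u v = 0) (huw : oinner u w = 0)
    (hvw : oinner v w = 0) : tcross u v w = omul u (omul (oconj v) w) := by
  have h : omul w (omul (oconj v) u) = -omul u (omul (oconj v) w) := by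
    rw [oconj_omul_of_orthogonal (v := v) (w := u) (by rwa [oinner_comm]), omul_neg_right,
      oconj_omul_of_orthogonal hvw, omul_neg_right,
      omul_oconj_of_orthogonal huw]
    simp
  rw [tcross, h, sub_neg_eq_add, ← two_smul ℝ, smul_smul]
  norm_num

theorem tcross_swap_left_right (u v w : Octonion) : tcross w v u = -tcross u v w := by
  rw [tcross, tcross, ← smul_neg, neg_sub]

theorem tcross_swap_right {u v w : Octonion} (huv : oinner u v = 0) (huw : oinner u w = 0)
    (hvw : oinner v w = 0) : tcross u w v = -tcross u v w := by
  rw [tcross_of_orthogonal huv huw hvw, tcross_of_orthogonal huw huv (by rwa [oinner_comm]),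
    oconj_omul_of_orthogonal hvw, omul_neg_right, neg_neg]

theorem oinner_tcross_tcross {u v w z : Octonion} (huv : oinner u v = 0) (huw : oinner u w = 0)
    (huz : oinner u z = 0) (hvw : oinner v w = 0) (hvz : oinner v z = 0) :
    oinner (tcross u v w) (tcross u v z) = oinner u u * (oinner v v * oinner w z) := by
  rw [tcross_of_orthogonal huv huw hvw, tcross_of_orthogonal huv huz hvz, oinner_omul_left,
    oinner_omul_left, oinner_oconj]

theorem finrank_octonion : Module.finrank ℝ Octonion = 8 := by
  simp [Module.finrank_prod, Quaternion.finrank_eq_four]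

/-- Eight orthonormal octonions span. -/
theorem span_eq_top_of_oinner_orthonormal {b : Fin 8 → Octonion}
    (hb : ∀ i j, oinner (b i) (b j) = if i = j then 1 else 0) :
    Submodule.span ℝ (Set.range b) = ⊤ := by
  refine LinearIndependent.span_eq_top_of_card_eq_finrank' ?_ (by rw [finrank_octonion, Fintype.card_fin])
  refine LinearMap.BilinForm.linearIndependent_of_iIsOrtho (B := oinnerForm) ?_ ?_
  · intro i j hij
    change oinner (b i) (b j) = 0
    rw [hb, if_neg hij]
  · intro i h
    have h' : oinner (b i) (b i) = 0 := h
    simp [hb] at h'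

/-- if orthonormal `u, v, w, z` span an L-plane, then
`{u, v, w, z, u×v×w, u×v×z, u×w×z, v×w×z}` is an orthonormal basis of `ℝ⁸`. -/
theorem L_plane_gives_orthonormal_basis (u v w z : Octonion)
    (horth : ∀ i j : Fin 4,
      oinner (![u, v, w, z] i) (![u, v, w, z] j) = if i = j then 1 else 0)
    (hL : ∀ a ∈ Submodule.span ℝ {u, v, w, z}, ∀ b ∈ Submodule.span ℝ {u, v, w, z},
      ∀ c ∈ Submodule.span ℝ {u, v, w, z}, ∀ d ∈ Submodule.span ℝ {u, v, w, z},
        cayleyΨ a b c d = 0) :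
    (∀ i j : Fin 8,
      oinner (![u, v, w, z, tcross u v w, tcross u v z, tcross u w z, tcross v w z] i)
        (![u, v, w, z, tcross u v w, tcross u v z, tcross u w z, tcross v w z] j) =
          if i = j then 1 else 0) ∧
    Submodule.span ℝ (Set.range
      ![u, v, w, z, tcross u v w, tcross u v z, tcross u w z, tcross v w z]) = ⊤ := by
  have huu : oinner u u = 1 := horth 0 0
  have huv : oinner u v = 0 := horth 0 1
  have huw : oinner u w = 0 := horth 0 2
  have huz : oinner u z = 0 := horth 0 3
  have hvu : oinner v u = 0 := horth 1 0
  have hvv : oinner v v = 1 := horth 1 1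
  have hvw : oinner v w = 0 := horth 1 2
  have hvz : oinner v z = 0 := horth 1 3
  have hwu : oinner w u = 0 := horth 2 0
  have hwv : oinner w v = 0 := horth 2 1
  have hww : oinner w w = 1 := horth 2 2
  have hwz : oinner w z = 0 := horth 2 3
  have hzu : oinner z u = 0 := horth 3 0
  have hzv : oinner z v = 0 := horth 3 1
  have hzw : oinner z w = 0 := horth 3 2
  have hzz : oinner z z = 1 := horth 3 3
  have mem : ∀ i, ![u, v, w, z] i ∈ Submodule.span ℝ {u, v, w, z} := by
    intro i
    apply Submodule.subset_span
    fin_cases i <;> simp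
  have cross (i j k l : Fin 4) :
      oinner (tcross (![u, v, w, z] i) (![u, v, w, z] j) (![u, v, w, z] k)) (![u, v, w, z] l) = 0 :=
    hL _ (mem i) _ (mem j) _ (mem k) _ (mem l)
  have cross_uvw : oinner (tcross u v w) u = 0 ∧ oinner (tcross u v w) v = 0 ∧
      oinner (tcross u v w) w = 0 ∧ oinner (tcross u v w) z = 0 :=
    ⟨cross 0 1 2 0, cross 0 1 2 1, cross 0 1 2 2, cross 0 1 2 3⟩
  have cross_uvz : oinner (tcross u v z) u = 0 ∧ oinner (tcross u v z) v = 0 ∧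
      oinner (tcross u v z) w = 0 ∧ oinner (tcross u v z) z = 0 :=
    ⟨cross 0 1 3 0, cross 0 1 3 1, cross 0 1 3 2, cross 0 1 3 3⟩
  have cross_uwz : oinner (tcross u w z) u = 0 ∧ oinner (tcross u w z) v = 0 ∧
      oinner (tcross u w z) w = 0 ∧ oinner (tcross u w z) z = 0 :=
    ⟨cross 0 2 3 0, cross 0 2 3 1, cross 0 2 3 2, cross 0 2 3 3⟩
  have cross_vwz : oinner (tcross v w z) u = 0 ∧ oinner (tcross v w z) v = 0 ∧
      oinner (tcross v w z) w = 0 ∧ oinner (tcross v w z) z = 0 :=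
    ⟨cross 1 2 3 0, cross 1 2 3 1, cross 1 2 3 2, cross 1 2 3 3⟩
  have uvw_uvw : oinner (tcross u v w) (tcross u v w) = 1 := by
    simp [oinner_tcross_tcross, *]
  have uvz_uvz : oinner (tcross u v z) (tcross u v z) = 1 := by
    simp [oinner_tcross_tcross, *]
  have uwz_uwz : oinner (tcross u w z) (tcross u w z) = 1 := by
    simp [oinner_tcross_tcross, *]
  have vwz_vwz : oinner (tcross v w z) (tcross v w z) = 1 := by
    simp [oinner_tcross_tcross, *]
  have uvw_uvz : oinner (tcross u v w) (tcross u v z) = 0 := by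
    rw [oinner_tcross_tcross huv huw huz hvw hvz, hwz, mul_zero, mul_zero]
  have uvw_uwz : oinner (tcross u v w) (tcross u w z) = 0 := by
    rw [tcross_swap_right huw huv hwv, oinner_neg_left,
      oinner_tcross_tcross huw huv huz hwv hwz, hvz, mul_zero, mul_zero, neg_zero]
  have uvw_vwz : oinner (tcross u v w) (tcross v w z) = 0 := by
    rw [tcross_swap_right huw huv hwv, tcross_swap_left_right v w u, neg_neg,
      oinner_tcross_tcross hvw hvu hvz hwu hwz, huz, mul_zero, mul_zero]
  have uvz_uwz : oinner (tcross u v z) (tcross u w z) = 0 := by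
    rw [tcross_swap_right huz huv hzv, tcross_swap_right huz huw hzw, oinner_neg_left,
      oinner_neg_right, oinner_tcross_tcross huz huv huw hzv hzw, hvw, mul_zero, mul_zero,
      neg_zero, neg_zero]
  have uvz_vwz : oinner (tcross u v z) (tcross v w z) = 0 := by
    rw [tcross_swap_right huz huv hzv, tcross_swap_left_right v z u, neg_neg,
      tcross_swap_right hvz hvw hzw, oinner_neg_right,
      oinner_tcross_tcross hvz hvu hvw hzu hzw, huw, mul_zero, mul_zero, neg_zero]
  have uwz_vwz : oinner (tcross u w z) (tcross v w z) = 0 := by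
    rw [tcross_swap_left_right z w u, tcross_swap_left_right z w v, oinner_neg_left,
      oinner_neg_right, oinner_tcross_tcross hzw hzu hzv hwu hwv, huv, mul_zero, mul_zero,
      neg_zero, neg_zero]
  suffices h : ∀ i j : Fin 8,
      oinner (![u, v, w, z, tcross u v w, tcross u v z, tcross u w z, tcross v w z] i)
        (![u, v, w, z, tcross u v w, tcross u v z, tcross u w z, tcross v w z] j) =
          if i = j then 1 else 0 from ⟨h, span_eq_top_of_oinner_orthonormal h⟩
  have key : ∀ i j : Fin 8, i ≤ j →
      oinner (![u, v, w, z, tcross u v w, tcross u v z, tcross u w z, tcross v w z] i)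
        (![u, v, w, z, tcross u v w, tcross u v z, tcross u w z, tcross v w z] j) =
          if i = j then 1 else 0 := by
    intro i j hij
    fin_cases i <;> fin_cases j <;>
      first
      | exact absurd hij (by decide)
      | (simp [*]; done)
      | (rw [oinner_comm]; simp [*])
  intro i j
  rcases le_total i j with h | h
  · exact key i j h
  · rw [oinner_comm, key j i h]
    simp only [eq_comm]
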